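/- Let r ≥ 1, c ≥ 1 and p be nonnegative integers with r ≥ p. Then, for every number N of variables and all x = (x_1,…,x_N), one has s((c^{r−p}, (c−1)^p); x) = Σ_ν o(ν; x), where the sum ranges over all partitions ν ⊆ (c^r) with oddrows((c^r)/ν) = p. -/

import Mathlib

open scoped Classical
open Finset

noncomputable section

/-- Complete homogeneous symmetric polynomial of degree `m` in the variables `x`
(`0` for negative `m`). -/
def hpoly {R : Type} [CommRing R] {N : ℕ} (x : Fin N → R) (m : ℤ) : R :=
  if 0 ≤ m then
    ∑ f ∈ Finset.univ.filter (fun f : Fin m.toNat → Fin N => Monotone f), ∏ i, x (f i)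
  else 0

/-- The Schur function `s(λ; x) = det(h_{λ_i-i+j})` (indices `1 ≤ i,j ≤ r`). -/
def schur {R : Type} [CommRing R] {N r : ℕ} (lam : Fin r → ℤ) (x : Fin N → R) : R :=
  Matrix.det (Matrix.of fun i j : Fin r =>
    hpoly x (lam i - ((i : ℕ) : ℤ) + ((j : ℕ) : ℤ)))

/-- The formal orthogonal character `o(λ; x)`. -/
def oChar {R : Type} [CommRing R] {N r : ℕ} (lam : Fin r → ℤ) (x : Fin N → R) : R :=
  Matrix.det (Matrix.of fun i j : Fin r =>
    hpoly x (lam i - ((i : ℕ) : ℤ) + ((j : ℕ) : ℤ)) -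
      hpoly x (lam i - ((i : ℕ) : ℤ) - ((j : ℕ) : ℤ) - 2))

/-- The number of odd rows of the skew shape `(C^n)/ν`. -/
def oddRowsCount {n : ℕ} (C : ℕ) (ν : Fin n → ℕ) : ℕ :=
  (Finset.univ.filter (fun i : Fin n => Odd ((C : ℤ) - (ν i : ℤ)))).card



def Vd {S : Type*} [CommRing S] {n : ℕ} (z : Fin n → S) : S :=
  ∏ i, ∏ j, if i < j then z j - z i else 1

def PP {S : Type*} [CommRing S] {n : ℕ} (z : Fin n → S) : S :=
  (∏ i, (1 - z i ^ 2)) * ∏ i, ∏ j, if i < j then 1 - z i * z j else 1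

theorem pair_split {S : Type*} [CommRing S] {n : ℕ} (g : Fin (n+1) → Fin (n+1) → S)
    (a : Fin (n+1)) :
    (∏ i, ∏ j, if i < j then g i j else 1) =
      (∏ k, if a < a.succAbove k then g a (a.succAbove k) else g (a.succAbove k) a) *
      ∏ k, ∏ l, if k < l then g (a.succAbove k) (a.succAbove l) else 1 := by
  rw [Fin.prod_univ_succAbove _ a]
  simp_rw [Fin.prod_univ_succAbove _ a]
  simp only [lt_irrefl, if_false, one_mul, Finset.prod_mul_distrib, Fin.succAbove_lt_succAbove_iff]
  rw [← mul_assoc, ← Finset.prod_mul_distrib]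
  congr 1
  refine Finset.prod_congr rfl fun k _ => ?_
  rcases lt_or_gt_of_ne (Fin.ne_succAbove a k) with h | h
  · simp [h, h.not_gt]
  · simp [h, h.not_gt]

theorem PP_split {S : Type*} [CommRing S] {n : ℕ} (z : Fin (n+1) → S) (a : Fin (n+1)) :
    PP z = (1 - z a ^ 2) * (∏ k, (1 - z a * z (a.succAbove k))) * PP (fun k => z (a.succAbove k)) := by
  unfold PP
  rw [pair_split (fun i j => 1 - z i * z j) a, Fin.prod_univ_succAbove _ a]
  have : (∏ k, if a < a.succAbove k then 1 - z a * z (a.succAbove k)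
      else 1 - z (a.succAbove k) * z a) = ∏ k, (1 - z a * z (a.succAbove k)) :=
    Finset.prod_congr rfl fun k _ => by split_ifs <;> ring
  rw [this]; ring

theorem Vd_split {S : Type*} [CommRing S] {n : ℕ} (z : Fin (n+1) → S) (a : Fin (n+1)) :
    Vd z = (-1) ^ (a : ℕ) * (∏ k, (z (a.succAbove k) - z a)) * Vd (fun k => z (a.succAbove k)) := by
  unfold Vd
  rw [pair_split (fun i j => z j - z i) a]
  congr 1
  have : ∀ k, (if a < a.succAbove k then z (a.succAbove k) - z a else z a - z (a.succAbove k))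
      = (if k.castSucc < a then (-1 : S) else 1) * (z (a.succAbove k) - z a) := by
    intro k
    have : a < a.succAbove k ↔ ¬ k.castSucc < a := by
      rw [Fin.lt_succAbove_iff_le_castSucc, not_lt]
    by_cases h : k.castSucc < a <;> simp [this, h]
  rw [Finset.prod_congr rfl fun k _ => this k, Finset.prod_mul_distrib]
  congr 1
  rw [Finset.prod_ite, Finset.prod_const, Finset.prod_const_one, mul_one]
  congr 1
  have h2 : (Finset.univ.filter fun k : Fin n => k.castSucc < a) =
      Finset.univ.filter fun k : Fin n => (k : ℕ) < a := by
    ext k; simp [Fin.lt_def]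
  rw [h2, Fin.card_filter_val_lt]
  omega

theorem Vd_eq {S : Type*} [CommRing S] {n : ℕ} (z : Fin n → S) :
    (Matrix.of fun i j : Fin n => z i ^ (j : ℕ)).det = Vd z := by
  have := Matrix.det_vandermonde z
  unfold Matrix.vandermonde at this
  rw [this, Vd]
  refine Finset.prod_congr rfl fun i _ => ?_
  rw [← Finset.prod_filter]
  congr 1
  ext j; simp

theorem lag {F : Type*} [Field F] {n : ℕ} (z : Fin n → F) (hz : Function.Injective z)
    (h0 : ∀ i, z i ≠ 0) (b : F) (hb0 : b ≠ 0) (hb : ∀ i, z i ≠ b) (Q : Polynomial F)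
    (hQ : Q.natDegree ≤ n) :
    Q.eval 0 / (-b * ∏ k, (- z k)) + Q.eval b / (b * ∏ k, (b - z k)) +
      ∑ i, Q.eval (z i) / (z i * (z i - b) * ∏ k, if k = i then 1 else z i - z k) = 0 := by
  let v : Option (Option (Fin n)) → F := fun o => o.elim 0 (fun o => o.elim b z)
  have hv : Function.Injective v := by
    rintro (_ | _ | i) (_ | _ | j) h <;> simp [v] at h ⊢
    · exact hb0 h.symm
    · exact h0 _ h.symm
    · exact hb0 h
    · exact hb _ h.symm
    · exact h0 _ h
    · exact hb _ h
    · exact hz h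
  have hcard : (Finset.univ : Finset (Option (Option (Fin n)))).card = n + 2 := by simp
  have hdeg : Q.degree < ((n + 2 : ℕ) : WithBot ℕ) :=
    lt_of_le_of_lt (Polynomial.degree_le_of_natDegree_le hQ) (by exact_mod_cast (by omega))
  have := Lagrange.coeff_eq_sum (s := Finset.univ) (v := v) (hv.injOn) (P := Q)
    (by rw [hcard]; exact hdeg)
  rw [hcard, Polynomial.coeff_eq_zero_of_natDegree_lt (by omega)] at this
  have he : ∀ i, ∏ j ∈ Finset.univ.erase i, (v i - v j) = ∏ j, if j = i then 1 else v i - v j := by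
    intro i
    rw [Finset.prod_ite]
    simp only [Finset.prod_const_one, one_mul]
    congr 1
    ext; simp
  simp_rw [he, Fintype.sum_option, Fintype.prod_option] at this
  simp [v] at this
  simp only [neg_mul, mul_assoc, add_assoc]
  exact this.symm

theorem KI_field {F : Type*} [Field F] {n : ℕ} (z : Fin (n+1) → F) (hz : Function.Injective z)
    (h0 : ∀ i, z i ≠ 0) (u t : F) (hu : u ≠ 0) (ht : t ≠ 0) (hut : ∀ i, u + t * z i ≠ 0) :
    ∑ i : Fin (n+1), (-1) ^ (i : ℕ) * (u * ((∏ k, z (i.succAbove k)) * (Vd (fun k => z (i.succAbove k)) *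
      (∏ k, (u + t * z (i.succAbove k))) * ((1 - z i ^ 2) * ∏ k, (1 - z i * z (i.succAbove k)))))) =
    Vd z * (∏ i, (u + t * z i) - (∏ i, z i) * ∏ i, (t + u * z i)) := by
  have L := lag z hz h0 (-u/t) (by simp [hu, ht])
    (fun i h => hut i (by rw [h]; field_simp; ring)) (∏ k, (1 - Polynomial.C (z k) * Polynomial.X))
    (by
      refine (Polynomial.natDegree_prod_le _ _).trans ?_
      refine (Finset.sum_le_card_nsmul _ _ 1 fun k _ => ?_).trans (by simp)
      compute_degree)
  simp only [Polynomial.eval_prod, Polynomial.eval_sub, Polynomial.eval_one, Polynomial.eval_mul,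
    Polynomial.eval_C, Polynomial.eval_X, mul_zero, sub_zero, Finset.prod_const_one] at L
  have hZ : ∏ k, z k ≠ 0 := Finset.prod_ne_zero_iff.2 fun i _ => h0 i
  have hU : ∏ k, (u + t * z k) ≠ 0 := Finset.prod_ne_zero_iff.2 fun i _ => hut i
  have e1 : ∏ k, (1 - z k * (-u/t)) = (∏ k, (t + u * z k)) / t ^ (n+1) := by
    rw [eq_div_iff (pow_ne_zero _ ht)]
    have : t ^ (n+1) = ∏ k : Fin (n+1), t := by simp
    rw [this, ← Finset.prod_mul_distrib]
    refine Finset.prod_congr rfl fun k _ => ?_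
    field_simp; ring
  have e2 : ∏ k, (-u/t - z k) = (-1)^(n+1) * (∏ k, (u + t * z k)) / t ^ (n+1) := by
    rw [eq_div_iff (pow_ne_zero _ ht)]
    have : t ^ (n+1) = ∏ k : Fin (n+1), t := by simp
    have h1 : (-1 : F) ^ (n+1) = ∏ k : Fin (n+1), (-1) := by simp
    rw [this, h1, ← Finset.prod_mul_distrib, ← Finset.prod_mul_distrib]
    refine Finset.prod_congr rfl fun k _ => ?_
    field_simp; ring
  have e3 : ∏ k, (- z k) = (-1)^(n+1) * ∏ k, z k := by
    have h1 : (-1 : F) ^ (n+1) = ∏ k : Fin (n+1), (-1) := by simp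
    rw [h1, ← Finset.prod_mul_distrib]; simp
  have key : ∀ i : Fin (n+1), (-1) ^ (i : ℕ) * (u * ((∏ k, z (i.succAbove k)) *
      (Vd (fun k => z (i.succAbove k)) *
      (∏ k, (u + t * z (i.succAbove k))) * ((1 - z i ^ 2) * ∏ k, (1 - z i * z (i.succAbove k)))))) =
      ((-1)^n * Vd z * u * (∏ k, z k) * (∏ k, (u + t * z k)) / t) * ((∏ k, (1 - z k * z i)) /
        (z i * (z i - -u/t) * ∏ k, if k = i then 1 else z i - z k)) := by
    intro i
    have d : ∏ k, (z (i.succAbove k) - z i) ≠ 0 := Finset.prod_ne_zero_iff.2 fun k _ =>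
      sub_ne_zero.2 fun h => Fin.succAbove_ne i k (hz h)
    have e4 : (∏ k, if k = i then 1 else z i - z k) =
        (-1)^n * ∏ k, (z (i.succAbove k) - z i) := by
      have h1 : (-1 : F) ^ n = ∏ k : Fin n, (-1) := by simp
      rw [Fin.prod_univ_succAbove _ i, h1, ← Finset.prod_mul_distrib]
      simp
    have e5 : z i - -u/t = (u + t * z i) / t := by field_simp; ring
    have e6 : ∏ k, (1 - z k * z i) = (1 - z i ^ 2) * ∏ k, (1 - z i * z (i.succAbove k)) := by
      rw [Fin.prod_univ_succAbove _ i]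
      congr 1
      · ring
      · exact Finset.prod_congr rfl fun k _ => by ring
    have hi := h0 i
    have hi' := hut i
    rw [e4, e5, e6, Vd_split z i, Fin.prod_univ_succAbove z i,
      Fin.prod_univ_succAbove (fun k => u + t * z k) i]
    have hs : (-1 : F) ^ n ≠ 0 := by simp
    field_simp
  rw [Finset.sum_congr rfl fun i _ => key i, ← Finset.mul_sum, eq_neg_of_add_eq_zero_right L,
    e1, e2, e3]
  have hs : (-1 : F) ^ n ≠ 0 := by simp
  have hs2 : (-1 : F) ^ (n+1) ≠ 0 := by simp
  have hs3 : (-1 : F) ^ (n+1) = - (-1)^n := by ring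
  rw [hs3]
  field_simp
  ring

theorem map_Vd {S T : Type*} [CommRing S] [CommRing T] (f : S →+* T) {n : ℕ} (z : Fin n → S) :
    f (Vd z) = Vd (fun i => f (z i)) := by
  simp [Vd, map_prod, apply_ite f]

theorem KI {S : Type*} [CommRing S] [IsDomain S] {n : ℕ} (z : Fin (n+1) → S)
    (hz : Function.Injective z)
    (h0 : ∀ i, z i ≠ 0) (u t : S) (hu : u ≠ 0) (ht : t ≠ 0) (hut : ∀ i, u + t * z i ≠ 0) :
    ∑ i : Fin (n+1), (-1) ^ (i : ℕ) * (u * ((∏ k, z (i.succAbove k)) * (Vd (fun k => z (i.succAbove k)) *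
      (∏ k, (u + t * z (i.succAbove k))) * ((1 - z i ^ 2) * ∏ k, (1 - z i * z (i.succAbove k)))))) =
    Vd z * (∏ i, (u + t * z i) - (∏ i, z i) * ∏ i, (t + u * z i)) := by
  let f := algebraMap S (FractionRing S)
  have hf : Function.Injective f := IsFractionRing.injective S (FractionRing S)
  have hf0 : ∀ x, x ≠ 0 → f x ≠ 0 := fun x hx h => hx (hf (by rw [h, map_zero]))
  apply hf
  have := KI_field (fun i => f (z i)) (hf.comp hz) (fun i => hf0 _ (h0 i)) (f u) (f t) (hf0 _ hu)
    (hf0 _ ht) (fun i => by simpa using hf0 _ (hut i))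
  simpa [map_Vd, map_sum, map_prod] using this


def DD (r M : ℕ) : Finset (Fin r → ℕ) :=
  (Fintype.piFinset fun _ : Fin r => Finset.range M).filter (fun d => StrictMono d)

theorem mem_DD {r M : ℕ} {d : Fin r → ℕ} : d ∈ DD r M ↔ (∀ i, d i < M) ∧ StrictMono d := by
  simp [DD]

def wt {S : Type*} [CommRing S] {r : ℕ} (u t : S) (d : Fin r → ℕ) : S :=
  ∏ i, if Even (d i + (i : ℕ)) then u else t

theorem sum_DD {S : Type*} [CommRing S] (r M : ℕ) (f : (Fin (r+1) → ℕ) → S) :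
    ∑ d ∈ DD (r+1) (M+1), f d =
      ∑ d ∈ DD r M, f (Fin.cons 0 (fun i => d i + 1)) +
      ∑ d ∈ DD (r+1) M, f (fun i => d i + 1) := by
  rw [← Finset.sum_filter_add_sum_filter_not (DD (r+1) (M+1)) (fun d => d 0 = 0)]
  congr 1
  · symm
    refine Finset.sum_nbij' (fun d => Fin.cons 0 (fun i => d i + 1)) (fun d i => d i.succ - 1)
      ?_ ?_ ?_ ?_ ?_
    · intro d hd
      rw [mem_DD] at hd
      rw [Finset.mem_filter, mem_DD]
      refine ⟨⟨fun i => ?_, ?_⟩, by simp⟩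
      · refine Fin.cases ?_ (fun i => ?_) i
        · simp
        · simpa using hd.1 i
      · intro i j
        refine Fin.cases ?_ (fun i => ?_) i <;> refine Fin.cases ?_ (fun j => ?_) j
        · simp
        · simp
        · simp
        · intro h
          simpa using hd.2 (Fin.succ_lt_succ_iff.1 h)
    · intro d hd
      rw [Finset.mem_filter, mem_DD] at hd
      rw [mem_DD]
      refine ⟨fun i => ?_, fun i j h => ?_⟩
      · have := hd.1.1 i.succ
        have := hd.1.2 (Fin.succ_pos i)
        omega
      · have := hd.1.2 (Fin.succ_lt_succ_iff.2 h)
        have := hd.1.2 (Fin.succ_pos i)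
        simp only
        omega
    · intro d hd
      ext i; simp
    · intro d hd
      rw [Finset.mem_filter, mem_DD] at hd
      ext i
      refine Fin.cases ?_ (fun i => ?_) i
      · simp [hd.2]
      · have := hd.1.2 (Fin.succ_pos i)
        simp only [Fin.cons_succ]
        omega
    · intro d hd; rfl
  · symm
    refine Finset.sum_nbij' (fun d i => d i + 1) (fun d i => d i - 1)
      ?_ ?_ ?_ ?_ ?_
    · intro d hd
      rw [mem_DD] at hd
      rw [Finset.mem_filter, mem_DD]
      refine ⟨⟨fun i => by simpa using hd.1 i, fun i j h => by simpa using hd.2 h⟩, by simp⟩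
    · intro d hd
      rw [Finset.mem_filter, mem_DD] at hd
      rw [mem_DD]
      have hp : ∀ i, 0 < d i := fun i =>
        lt_of_lt_of_le (Nat.pos_of_ne_zero hd.2) (hd.1.2.monotone (Fin.zero_le i))
      refine ⟨fun i => ?_, fun i j h => ?_⟩
      · have := hd.1.1 i
        have := hp i
        omega
      · have := hd.1.2 h
        have := hp i
        simp only
        omega
    · intro d hd
      ext i; simp
    · intro d hd
      rw [Finset.mem_filter, mem_DD] at hd
      have hp : ∀ i, 0 < d i := fun i =>
        lt_of_lt_of_le (Nat.pos_of_ne_zero hd.2) (hd.1.2.monotone (Fin.zero_le i))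
      ext i
      have := hp i
      simp only
      omega
    · intro d hd; rfl

theorem wt_cons {S : Type*} [CommRing S] {r : ℕ} (u t : S) (d : Fin r → ℕ) :
    wt u t (Fin.cons 0 (fun i => d i + 1) : Fin (r+1) → ℕ) = u * wt u t d := by
  unfold wt
  rw [Fin.prod_univ_succ]
  simp only [Fin.cons_zero, Fin.val_zero, Fin.cons_succ, Fin.val_succ]
  congr 1
  refine Finset.prod_congr rfl fun i _ => ?_
  have : Even (d i + 1 + ((i : ℕ) + 1)) ↔ Even (d i + i) := by
    rw [show d i + 1 + ((i : ℕ) + 1) = d i + i + 2 by ring]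
    simp [Nat.even_add]
  simp only [this]

theorem wt_shift {S : Type*} [CommRing S] {r : ℕ} (u t : S) (d : Fin r → ℕ) :
    wt u t (fun i => d i + 1) = wt t u d := by
  unfold wt
  refine Finset.prod_congr rfl fun i _ => ?_
  have : Even (d i + 1 + (i : ℕ)) ↔ ¬ Even (d i + i) := by
    rw [show d i + 1 + (i : ℕ) = d i + i + 1 by ring, Nat.even_add_one]
  by_cases h : Even (d i + i) <;> simp [this, h]

def alt {S : Type*} [CommRing S] {r : ℕ} (z : Fin r → S) (d : Fin r → ℕ) : S :=
  (Matrix.of fun i j : Fin r => z i ^ d j).det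

theorem alt_shift {S : Type*} [CommRing S] {r : ℕ} (z : Fin r → S) (d : Fin r → ℕ) :
    alt z (fun i => d i + 1) = (∏ i, z i) * alt z d := by
  unfold alt
  rw [← Matrix.det_mul_column]
  congr 1
  ext i j
  simp [pow_succ, mul_comm]

theorem alt_cons {S : Type*} [CommRing S] {r : ℕ} (z : Fin (r+1) → S) (d : Fin r → ℕ) :
    alt z (Fin.cons 0 (fun i => d i + 1)) =
      ∑ i : Fin (r+1), (-1) ^ (i : ℕ) * ((∏ k, z (i.succAbove k)) *
        alt (fun k => z (i.succAbove k)) d) := by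
  conv_lhs => unfold alt
  rw [Matrix.det_succ_column_zero]
  refine Finset.sum_congr rfl fun i _ => ?_
  rw [← alt_shift]
  simp only [Matrix.of_apply, Fin.cons_zero, pow_zero, mul_one]
  congr 1

def AA {S : Type*} [CommRing S] {r : ℕ} (M : ℕ) (z : Fin r → S) (u t : S) : S :=
  ∑ d ∈ DD r M, wt u t d * alt z d

theorem AA_succ {S : Type*} [CommRing S] {r : ℕ} (M : ℕ) (z : Fin (r+1) → S) (u t : S) :
    AA (M+1) z u t = (∑ i : Fin (r+1), (-1) ^ (i : ℕ) * (u * ((∏ k, z (i.succAbove k)) *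
        AA M (fun k => z (i.succAbove k)) u t))) + (∏ i, z i) * AA M z t u := by
  unfold AA
  rw [sum_DD]
  simp only [wt_cons, wt_shift, alt_shift, alt_cons, Finset.mul_sum]
  congr 1
  · rw [Finset.sum_comm]
    refine Finset.sum_congr rfl fun i _ => Finset.sum_congr rfl fun d _ => ?_
    ring
  · refine Finset.sum_congr rfl fun d _ => ?_
    ring

theorem span_mul {S : Type*} [CommRing S] {r : ℕ} (M : ℕ) (z : Fin r → S) (x : S)
    (I : Ideal S) (hI : ∀ i, z i ^ (M+1) ∈ I)
    (hx : x ∈ Ideal.span (Set.range fun i => z i ^ M)) : (∏ i, z i) * x ∈ I := by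
  refine Submodule.span_induction (p := fun x _ => (∏ i, z i) * x ∈ I) ?_ ?_ ?_ ?_ hx
  · rintro _ ⟨i, rfl⟩
    rw [← Finset.mul_prod_erase _ _ (Finset.mem_univ i)]
    have : (z i * ∏ j ∈ Finset.univ.erase i, z j) * (fun i => z i ^ M) i =
      (∏ j ∈ Finset.univ.erase i, z j) * z i ^ (M+1) := by simp only []; ring
    rw [this]
    exact I.mul_mem_left _ (hI i)
  · simp
  · intro a b _ _ ha hb
    rw [mul_add]; exact I.add_mem ha hb
  · intro a b _ hb
    rw [smul_eq_mul, mul_left_comm]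
    exact I.mul_mem_left _ hb

theorem TT {S : Type*} [CommRing S] [IsDomain S] (M : ℕ) : ∀ {r : ℕ} (z : Fin r → S)
    (_ : Function.Injective z) (_ : ∀ i, z i ≠ 0) (u t : S) (_ : u ≠ 0) (_ : t ≠ 0)
    (_ : ∀ i, u + t * z i ≠ 0) (_ : ∀ i, t + u * z i ≠ 0),
    AA M z u t * PP z - Vd z * ∏ i, (u + t * z i) ∈
      Ideal.span (Set.range fun i => z i ^ M) := by
  have base : ∀ (M : ℕ) (z : Fin 0 → S) (u t : S),
      AA M z u t * PP z - Vd z * ∏ i, (u + t * z i) ∈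
      Ideal.span (Set.range fun i => z i ^ M) := by
    intro M z u t
    have : DD 0 M = {Fin.elim0} := by
      ext d
      rw [mem_DD, Finset.mem_singleton]
      exact ⟨fun _ => Subsingleton.elim _ _, fun h => ⟨fun i => i.elim0, fun i => i.elim0⟩⟩
    simp [AA, this, PP, Vd, wt, alt]
  induction M with
  | zero =>
    intro r z _ _ u t _ _ _ _
    cases r with
    | zero => exact base _ _ _ _
    | succ r =>
      have : (1 : S) ∈ Ideal.span (Set.range fun i => z i ^ 0) :=
        Ideal.subset_span ⟨0, by simp⟩
      rw [(Ideal.eq_top_iff_one _).2 this]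
      trivial
  | succ M ih =>
    intro r z hz h0 u t hu ht hut htu
    cases r with
    | zero => exact base _ _ _ _
    | succ r =>
      set I := Ideal.span (Set.range fun i => z i ^ (M+1)) with hI
      have hzI : ∀ i, z i ^ (M+1) ∈ I := fun i => Ideal.subset_span ⟨i, rfl⟩
      have h1 := span_mul M z _ I hzI (ih z hz h0 t u ht hu htu hut)
      have h2 : ∀ i : Fin (r+1), (-1) ^ (i : ℕ) * (u * ((∏ k, z (i.succAbove k)) *
        (AA M (fun k => z (i.succAbove k)) u t * PP (fun k => z (i.succAbove k)) -
          Vd (fun k => z (i.succAbove k)) * ∏ k, (u + t * z (i.succAbove k))) *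
          ((1 - z i ^ 2) * ∏ k, (1 - z i * z (i.succAbove k))))) ∈ I := fun i =>
        I.mul_mem_left _ (I.mul_mem_left _ (I.mul_mem_right _
          (span_mul M (fun k => z (i.succAbove k)) _ I (fun k => hzI _)
            (ih (fun k => z (i.succAbove k)) (hz.comp Fin.succAbove_right_injective)
              (fun k => h0 _) u t hu ht (fun k => hut _) (fun k => htu _)))))
      have h3 := I.add_mem (I.sum_mem (t := Finset.univ) fun i _ => h2 i) h1
      convert h3 using 1
      have K := KI z hz h0 u t hu ht hut
      rw [AA_succ]
      have e : ∀ i : Fin (r+1), (-1) ^ (i : ℕ) * (u * ((∏ k, z (i.succAbove k)) *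
        (AA M (fun k => z (i.succAbove k)) u t * PP (fun k => z (i.succAbove k)) -
          Vd (fun k => z (i.succAbove k)) * ∏ k, (u + t * z (i.succAbove k))) *
          ((1 - z i ^ 2) * ∏ k, (1 - z i * z (i.succAbove k))))) =
          (-1) ^ (i : ℕ) * (u * ((∏ k, z (i.succAbove k)) *
            AA M (fun k => z (i.succAbove k)) u t)) * PP z -
          (-1) ^ (i : ℕ) * (u * ((∏ k, z (i.succAbove k)) * (Vd (fun k => z (i.succAbove k)) *
      (∏ k, (u + t * z (i.succAbove k))) * ((1 - z i ^ 2) * ∏ k, (1 - z i * z (i.succAbove k)))))) := by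
        intro i
        rw [PP_split z i]; ring
      rw [Finset.sum_congr rfl fun i _ => e i, Finset.sum_sub_distrib, K, ← Finset.sum_mul]
      ring


def cc (S : Type*) [CommRing S] : ℕ → ℕ → S
  | 0, l => if l = 0 then 1 else 0
  | 1, l => if l = 0 then 1 else 0
  | (m+2), l => cc S (m+1) l - if 2 ≤ l then cc S m (l-2) else 0

theorem cc_zero (S : Type*) [CommRing S] : ∀ m, cc S m 0 = 1
  | 0 => by simp [cc]
  | 1 => by simp [cc]
  | (m+2) => by simp [cc, cc_zero S (m+1)]

theorem cc_gt (S : Type*) [CommRing S] : ∀ m l, m < l → cc S m l = 0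
  | 0, l, h => by simp [cc]; omega
  | 1, l, h => by simp [cc]; omega
  | (m+2), l, h => by
    rw [cc, cc_gt S (m+1) l (by omega), if_pos (by omega), cc_gt S m (l-2) (by omega)]; simp

theorem cc_sum {S : Type*} [CommRing S] (z : S) : ∀ m,
    ∑ l ∈ Finset.range (m+1), cc S m l * (z ^ l * (1 + z^2) ^ (m - l)) =
      ∑ k ∈ Finset.range (m+1), z ^ (2*k)
  | 0 => by simp [cc]
  | 1 => by simp [cc, Finset.sum_range_succ]
  | (m+2) => by
    have h1 := cc_sum z (m+1)
    have h0 := cc_sum z m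
    have e1 : ∑ l ∈ Finset.range (m+2+1), cc S (m+1) l * (z ^ l * (1 + z^2) ^ (m + 2 - l)) =
        (1 + z^2) * ∑ k ∈ Finset.range (m+1+1), z ^ (2*k) := by
      rw [← h1, Finset.sum_range_succ, cc_gt S (m+1) (m+2) (by omega), zero_mul, add_zero,
        Finset.mul_sum]
      refine Finset.sum_congr rfl fun l hl => ?_
      rw [Finset.mem_range] at hl
      rw [show m + 2 - l = (m + 1 - l) + 1 by omega, pow_succ]
      ring
    have e2 : ∑ l ∈ Finset.range (m+2+1), (if 2 ≤ l then cc S m (l-2) else 0) *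
        (z ^ l * (1 + z^2) ^ (m + 2 - l)) = z ^ 2 * ∑ k ∈ Finset.range (m+1), z ^ (2*k) := by
      rw [← h0, Finset.sum_range_succ', Finset.sum_range_succ', Finset.mul_sum]
      simp only [show ¬ (2 ≤ 0 + 1) by omega, show ¬ (2 ≤ 0) by omega, if_false, zero_mul, add_zero]
      refine Finset.sum_congr rfl fun l hl => ?_
      rw [if_pos (by omega), show l + 1 + 1 - 2 = l by omega,
        show m + 2 - (l + 1 + 1) = m - l by omega]
      ring
    simp only [cc, sub_mul, Finset.sum_sub_distrib]
    rw [e1, e2, Finset.sum_range_succ _ (m+2), Finset.sum_range_succ _ (m+1)]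
    ring

theorem WW {S : Type*} [CommRing S] {r : ℕ} (z : Fin r → S) :
    (Matrix.of fun i j : Fin r => z i ^ (j : ℕ) - z i ^ (2 * r - j)).det = Vd z * PP z := by
  have h : (Matrix.of fun i j : Fin r => z i ^ (j : ℕ) - z i ^ (2 * r - j)) =
      Matrix.of fun i j => (1 - z i ^ 2) *
        (Matrix.projVandermonde z (fun i => 1 + z i ^ 2) *
          Matrix.of fun l j : Fin r => if j ≤ l then cc S (r - 1 - j) (l - j) else 0) i j := by
    ext i j
    have hj := j.2
    obtain ⟨m, hm⟩ : ∃ m, r = j + m + 1 := ⟨r - 1 - j, by omega⟩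
    simp only [Matrix.of_apply, Matrix.mul_apply, Matrix.projVandermonde_apply, Fin.val_rev]
    have e : ∑ l : Fin r, z i ^ (l : ℕ) * (1 + z i ^ 2) ^ (r - (l + 1)) *
        (if j ≤ l then cc S (r - 1 - j) (l - j) else 0) =
        z i ^ (j : ℕ) * ∑ k ∈ Finset.range (m+1), z i ^ (2*k) := by
      rw [← cc_sum, Finset.mul_sum]
      have := Fin.sum_univ_eq_sum_range (fun l => z i ^ l * (1 + z i ^ 2) ^ (r - (l + 1)) *
        (if (j : ℕ) ≤ l then cc S (r - 1 - j) (l - j) else 0)) r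
      simp only [Fin.le_def]
      rw [this]
      rw [show Finset.range r = Finset.range ((j : ℕ) + (m + 1)) by congr 1,
        Finset.sum_range_add]
      rw [Finset.sum_eq_zero, zero_add]
      · refine Finset.sum_congr rfl fun l hl => ?_
        rw [Finset.mem_range] at hl
        rw [if_pos (by omega), show r - 1 - j = m by omega, show (j : ℕ) + l - j = l by omega,
          show r - ((j : ℕ) + l + 1) = m - l by omega, pow_add]
        ring
      · intro l hl
        rw [Finset.mem_range] at hl
        rw [if_neg (by omega), mul_zero]
    rw [e]
    have g : (1 - z i ^ 2) * ∑ k ∈ Finset.range (m+1), z i ^ (2*k) = 1 - z i ^ (2 * (m+1)) := by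
      simp only [pow_mul]
      rw [mul_neg_geom_sum]
    rw [mul_left_comm, g, mul_sub, mul_one, ← pow_add]
    congr 2
    omega
  rw [h]
  rw [show (Matrix.of fun i j => (1 - z i ^ 2) *
        (Matrix.projVandermonde z (fun i => 1 + z i ^ 2) *
          Matrix.of fun l j : Fin r => if j ≤ l then cc S (r - 1 - j) (l - j) else 0) i j).det = _
      from Matrix.det_mul_column (fun i => 1 - z i ^ 2) _]
  rw [Matrix.det_mul, Matrix.det_projVandermonde]
  rw [Matrix.det_of_isLowerTriangular (Matrix.of fun l j : Fin r =>
    if j ≤ l then cc S (r - 1 - j) (l - j) else 0)]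
  · simp only [Matrix.of_apply, le_refl, if_true, Nat.sub_self, cc_zero, Finset.prod_const_one,
      mul_one]
    unfold PP Vd
    rw [mul_left_comm]
    congr 1
    rw [← Finset.prod_mul_distrib]
    refine Finset.prod_congr rfl fun i _ => ?_
    rw [← Finset.prod_mul_distrib, show Finset.Ioi i = Finset.univ.filter (fun j => i < j) by
      ext; simp, Finset.prod_filter]
    refine Finset.prod_congr rfl fun j _ => ?_
    split_ifs
    · ring
    · ring
  · intro i j hij
    simp only [Matrix.of_apply]
    exact if_neg (not_le.2 hij)

/-- The one-variable functional -/
def ell {A : Type*} [CommRing A] (w : ℕ → A) (f : Polynomial A) : A := f.sum fun n a => a * w n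

theorem ell_X_pow {A : Type*} [CommRing A] (w : ℕ → A) (n : ℕ) :
    ell w (Polynomial.X ^ n) = w n := by
  unfold ell
  rw [← Polynomial.monomial_one_right_eq_X_pow, Polynomial.sum_monomial_index] <;> simp

theorem ell_add {A : Type*} [CommRing A] (w : ℕ → A) (f g : Polynomial A) :
    ell w (f + g) = ell w f + ell w g := by
  unfold ell
  exact Polynomial.sum_add_index _ _ _ (by simp) (by intros; ring)

theorem ell_C_mul {A : Type*} [CommRing A] (w : ℕ → A) (a : A) (g : Polynomial A) :
    ell w (Polynomial.C a * g) = a * ell w g := by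
  unfold ell
  rw [← Polynomial.smul_eq_C_mul, Polynomial.sum_smul_index _ _ _ (by simp), Polynomial.sum_def,
    Polynomial.sum_def, Finset.mul_sum]
  exact Finset.sum_congr rfl fun _ _ => by ring

theorem ell_neg {A : Type*} [CommRing A] (w : ℕ → A) (g : Polynomial A) :
    ell w (-g) = - ell w g := by
  have := ell_C_mul w (-1) g
  simpa using this

theorem ell_sub {A : Type*} [CommRing A] (w : ℕ → A) (f g : Polynomial A) :
    ell w (f - g) = ell w f - ell w g := by
  rw [sub_eq_add_neg, ell_add, ell_neg, sub_eq_add_neg]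

/-- The multi-variable functional -/
def LL {A : Type*} [CommRing A] (r : ℕ) (w : ℕ → A) : MvPolynomial (Fin r) A →ₗ[A] A :=
  (MvPolynomial.basisMonomials (Fin r) A).constr A fun m => ∏ i, w (m i)

theorem LL_monomial {A : Type*} [CommRing A] (r : ℕ) (w : ℕ → A) (m : Fin r →₀ ℕ) (a : A) :
    LL r w (MvPolynomial.monomial m a) = a * ∏ i, w (m i) := by
  have h : MvPolynomial.monomial m a = a • (MvPolynomial.basisMonomials (Fin r) A) m := by
    simp [MvPolynomial.smul_monomial]
  rw [h, map_smul, LL, Module.Basis.constr_basis, smul_eq_mul]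

theorem LL_prod {A : Type*} [CommRing A] (r : ℕ) (w : ℕ → A) (f : Fin r → Polynomial A) :
    LL r w (∏ i, Polynomial.aeval (MvPolynomial.X i : MvPolynomial (Fin r) A) (f i)) =
      ∏ i, ell w (f i) := by
  simp only [ell, Polynomial.aeval_eq_sum_range, Polynomial.sum_def]
  have hs : ∀ i, ∑ n ∈ (f i).support, (f i).coeff n * w n =
      ∑ n ∈ Finset.range ((f i).natDegree + 1), (f i).coeff n * w n := by
    intro i
    refine Finset.sum_subset ?_ ?_
    · exact Polynomial.supp_subset_range_natDegree_succ
    · intro n _ hn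
      rw [Polynomial.notMem_support_iff.1 hn, zero_mul]
  simp only [hs]
  rw [Finset.prod_univ_sum, Finset.prod_univ_sum, map_sum]
  refine Finset.sum_congr rfl fun p _ => ?_
  have : ∏ i, (f i).coeff (p i) • (MvPolynomial.X i : MvPolynomial (Fin r) A) ^ p i =
      MvPolynomial.monomial (Finsupp.equivFunOnFinite.symm p) (∏ i, (f i).coeff (p i)) := by
    rw [MvPolynomial.monomial_eq, Finsupp.prod_fintype _ _ (by simp), map_prod,
      ← Finset.prod_mul_distrib]
    refine Finset.prod_congr rfl fun i _ => ?_
    simp [MvPolynomial.smul_eq_C_mul]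
  rw [this, LL_monomial, Finset.prod_mul_distrib]
  simp

theorem LL_ideal {A : Type*} [CommRing A] (r M : ℕ) (w : ℕ → A) (hw : ∀ n, M ≤ n → w n = 0)
    (x : MvPolynomial (Fin r) A)
    (hx : x ∈ Ideal.span (Set.range fun i => (MvPolynomial.X i : MvPolynomial (Fin r) A) ^ M)) :
    LL r w x = 0 := by
  refine Submodule.span_induction (p := fun x _ => ∀ g, LL r w (g * x) = 0) ?_ ?_ ?_ ?_ hx 1
    |> fun h => by simpa using h
  · rintro _ ⟨i, rfl⟩ g
    induction g using MvPolynomial.induction_on' with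
    | monomial m a =>
      simp only []
      rw [MvPolynomial.X_pow_eq_monomial, MvPolynomial.monomial_mul, LL_monomial]
      rw [Finset.prod_eq_zero (Finset.mem_univ i), mul_zero]
      apply hw
      simp
    | add p q hp hq => rw [add_mul, map_add, hp, hq, add_zero]
  · simp
  · intro a b _ _ ha hb g
    rw [mul_add, map_add, ha, hb, add_zero]
  · intro a b _ hb g
    rw [smul_eq_mul, ← mul_assoc]
    exact hb _

open MvPolynomial in
theorem andreief {A : Type*} [CommRing A] (r : ℕ) (w : ℕ → A) (f g : Fin r → Polynomial A) :
    LL r w ((Matrix.of fun i j : Fin r =>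
        Polynomial.aeval (X i : MvPolynomial (Fin r) A) (f j)).det *
      (Matrix.of fun i j : Fin r => Polynomial.aeval (X i : MvPolynomial (Fin r) A) (g j)).det) =
      (r.factorial : A) * (Matrix.of fun i j : Fin r => ell w (f i * g j)).det := by
  rw [Matrix.det_apply', Finset.sum_mul, map_sum]
  have key : ∀ σ : Equiv.Perm (Fin r),
      LL r w (((Equiv.Perm.sign σ : ℤ) : MvPolynomial (Fin r) A) * (∏ i, (Matrix.of fun i j : Fin r =>
        Polynomial.aeval (X i : MvPolynomial (Fin r) A) (f j)) (σ i) i) *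
      (Matrix.of fun i j : Fin r => Polynomial.aeval (X i : MvPolynomial (Fin r) A) (g j)).det) =
      (Matrix.of fun i j : Fin r => ell w (f i * g j)).det := by
    intro σ
    have h1 : ((Equiv.Perm.sign σ : ℤ) : MvPolynomial (Fin r) A) *
        (Matrix.of fun i j : Fin r => Polynomial.aeval (X i : MvPolynomial (Fin r) A) (g j)).det =
        (Matrix.of fun i j : Fin r =>
          Polynomial.aeval (X (σ i) : MvPolynomial (Fin r) A) (g j)).det := by
      rw [← Matrix.det_permute]; rfl
    rw [mul_right_comm, h1]
    have h2 : (∏ i, (Matrix.of fun i j : Fin r =>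
        Polynomial.aeval (X i : MvPolynomial (Fin r) A) (f j)) (σ i) i) *
        (Matrix.of fun i j : Fin r =>
          Polynomial.aeval (X (σ i) : MvPolynomial (Fin r) A) (g j)).det =
        (Matrix.of fun i j : Fin r =>
          Polynomial.aeval (X (σ i) : MvPolynomial (Fin r) A) (f i * g j)).det := by
      simp only [map_mul, Matrix.of_apply]
      exact (Matrix.det_mul_column _ _).symm
    rw [mul_comm, h2, ← Matrix.det_transpose, Matrix.det_apply, map_sum,
      ← Matrix.det_transpose, Matrix.det_apply]
    refine Finset.sum_congr rfl fun τ _ => ?_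
    have h3 : ∏ i, (Matrix.of fun i j : Fin r =>
          Polynomial.aeval (X (σ i) : MvPolynomial (Fin r) A) (f i * g j)).transpose (τ i) i =
        ∏ k, Polynomial.aeval (X k : MvPolynomial (Fin r) A) (f (σ.symm k) * g (τ (σ.symm k))) := by
      symm
      rw [← Equiv.prod_comp σ]
      simp [Matrix.transpose_apply]
    have h4 : ∏ i, (Matrix.of fun i j : Fin r => ell w (f i * g j)).transpose (τ i) i =
        ∏ k, ell w (f (σ.symm k) * g (τ (σ.symm k))) := by
      symm
      rw [← Equiv.prod_comp σ]
      simp [Matrix.transpose_apply]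
    rw [h3, h4, ← LL_prod]
    rcases Int.units_eq_one_or (Equiv.Perm.sign τ) with h | h <;> simp [h]
  rw [Finset.sum_congr rfl fun σ _ => key σ]
  simp [Fintype.card_perm]


theorem rows_tri {A : Type*} [CommRing A] (r : ℕ) (t : A) (v : ℕ → Fin r → A) (k : ℕ)
    (hk : k < r) :
    (Matrix.of fun i : Fin r => if (i : ℕ) < k then v i + t • v (i+1) else
      if (i : ℕ) = k then v i else v (i+1)).det =
    (Matrix.of fun i : Fin r => if (i : ℕ) < k + 1 then v i else v (i+1)).det := by
  have h : (Matrix.of fun i : Fin r => if (i : ℕ) < k then v i + t • v (i+1) else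
      if (i : ℕ) = k then v i else v (i+1)) =
      (Matrix.of fun i j : Fin r => if i = j then (1 : A) else
        if (i : ℕ) < k ∧ (j : ℕ) = i + 1 then t else 0) *
      (Matrix.of fun i : Fin r => if (i : ℕ) < k + 1 then v i else v (i+1)) := by
    ext i j
    rw [Matrix.mul_apply, ← Finset.add_sum_erase _ _ (Finset.mem_univ i)]
    simp only [Matrix.of_apply, if_true, one_mul]
    by_cases hi : (i : ℕ) < k
    · rw [Finset.sum_eq_single (⟨i + 1, by omega⟩ : Fin r)]
      · have : i ≠ ⟨(i : ℕ) + 1, by omega⟩ := by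
          intro h; have := congrArg Fin.val h; simp at this
        simp [hi, this, show (i : ℕ) < k + 1 by omega]
      · intro b hb hb'
        have h1 : i ≠ b := fun h => by simp [h] at hb
        have h2 : ¬ (b : ℕ) = i + 1 := fun h => hb' (Fin.ext h)
        simp [h1, h2]
      · intro h
        exfalso
        apply h
        simp only [Finset.mem_erase, Finset.mem_univ, and_true]
        intro h; have := congrArg Fin.val h; simp at this
    · rw [Finset.sum_eq_zero]
      · by_cases h : (i : ℕ) = k
        · simp [h]
        · simp [h, hi, show ¬ (i : ℕ) < k + 1 by omega]
      · intro b hb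
        have h1 : i ≠ b := fun h => by simp [h] at hb
        simp [h1, hi]
  rw [h, Matrix.det_mul, Matrix.det_of_isUpperTriangular]
  · simp
  · intro i j hij
    have hij' : j < i := hij
    have h1 : i ≠ j := hij'.ne'
    have h2 : ¬ (j : ℕ) = i + 1 := by
      rw [Fin.lt_def] at hij'; omega
    simp [h1, h2]

theorem rows_aux {A : Type*} [CommRing A] (r : ℕ) (t : A) (v : ℕ → Fin r → A) (k : ℕ)
    (hk : k ≤ r) :
    (Matrix.of fun i : Fin r => if (i : ℕ) < k then v i + t • v (i+1) else v (i+1)).det =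
    ∑ l ∈ Finset.range (k+1), t ^ (k - l) *
      (Matrix.of fun i : Fin r => if (i : ℕ) < l then v i else v (i+1)).det := by
  induction k with
  | zero => simp
  | succ k ih =>
    have ih := ih (by omega)
    set F := (Matrix.of fun i : Fin r => if (i : ℕ) < k then v i + t • v (i+1) else v (i+1)) with hF
    let a : Fin r := ⟨k, by omega⟩
    have e1 : (Matrix.of fun i : Fin r => if (i : ℕ) < k + 1 then v i + t • v (i+1) else v (i+1)) =
        F.updateRow a (v k + t • v (k+1)) := by
      ext i j
      by_cases h : i = a
      · subst h
        simp [a]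
      · have h' : ¬ (i : ℕ) = k := fun h' => h (Fin.ext h')
        rw [Matrix.updateRow_ne h]
        by_cases h2 : (i : ℕ) < k
        · simp [hF, h2, show (i : ℕ) ≤ k by omega]
        · simp [hF, h2, show ¬ (i : ℕ) ≤ k by omega]
    have e2 : F.updateRow a (v (k+1)) = F := by
      ext i j
      by_cases h : i = a
      · subst h
        simp [a, hF]
      · rw [Matrix.updateRow_ne h]
    have e3 : F.updateRow a (v k) = (Matrix.of fun i : Fin r =>
        if (i : ℕ) < k then v i + t • v (i+1) else
          if (i : ℕ) = k then v i else v (i+1)) := by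
      ext i j
      by_cases h : i = a
      · subst h
        simp [a]
      · have h' : ¬ (i : ℕ) = k := fun h' => h (Fin.ext h')
        rw [Matrix.updateRow_ne h]
        simp [hF, h']
    rw [e1, Matrix.det_updateRow_add, Matrix.det_updateRow_smul, e2, e3, rows_tri r t v k (by omega),
      ih, Finset.sum_range_succ _ (k+1), Finset.mul_sum, add_comm]
    congr 1
    · refine Finset.sum_congr rfl fun l hl => ?_
      rw [Finset.mem_range] at hl
      rw [show k + 1 - l = (k - l) + 1 by omega, pow_succ]
      ring
    · simp

theorem det_rev {A : Type*} [CommRing A] (r : ℕ) (M : Fin r → Fin r → A) :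
    (Matrix.of fun i j => M i (Fin.rev j)).det =
      ((Equiv.Perm.sign (Fin.revPerm : Equiv.Perm (Fin r)) : ℤ) : A) *
      (Matrix.of M).det := by
  rw [← Matrix.det_permute']; rfl

theorem core {A : Type*} [CommRing A] [IsDomain A] [CharZero A] (t : A) (ht : t ≠ 0) (hh : ℤ → A)
    (hneg : ∀ m, m < 0 → hh m = 0) (r c : ℕ) :
    (Matrix.of fun i j : Fin r => hh ((c : ℤ) - (i : ℕ) + (j : ℕ)) +
      t * hh ((c : ℤ) - (i : ℕ) + (j : ℕ) - 1)).det =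
    ∑ d ∈ DD r (c + r), wt 1 t d * (Matrix.of fun i j : Fin r =>
      hh ((c : ℤ) - (d i : ℕ) + (j : ℕ)) - hh ((c : ℤ) - (d i : ℕ) - (j : ℕ) - 2)).det := by
  let w : ℕ → A := fun n => hh ((c : ℤ) + r - 1 - n)
  have hw : ∀ n, c + r ≤ n → w n = 0 := fun n hn => hneg _ (by omega)
  let Z : Fin r → MvPolynomial (Fin r) A := MvPolynomial.X
  have hC : Function.Injective (MvPolynomial.C : A → MvPolynomial (Fin r) A) :=
    MvPolynomial.C_injective _ _
  have hx := TT (c + r) Z (MvPolynomial.X_injective) (fun i => MvPolynomial.X_ne_zero i) 1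
    (MvPolynomial.C t) one_ne_zero (fun h => ht (hC (by rw [h, map_zero])))
    (fun i h => by
      have := congrArg (MvPolynomial.constantCoeff) h
      simp [Z] at this)
    (fun i h => by
      have := congrArg (MvPolynomial.constantCoeff) h
      simp [Z] at this
      exact ht this)
  have hL := LL_ideal r (c+r) w hw _ (Ideal.mul_mem_left _ (Vd Z) hx)
  have e1 : Vd Z * (AA (c+r) Z 1 (MvPolynomial.C t) * PP Z -
      Vd Z * ∏ i, (1 + MvPolynomial.C t * Z i)) =
      ∑ d ∈ DD r (c + r), wt 1 t d • ((Matrix.of fun i j : Fin r =>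
        Polynomial.aeval (MvPolynomial.X i : MvPolynomial (Fin r) A) (Polynomial.X ^ d j : Polynomial A)).det *
        (Matrix.of fun i j : Fin r =>
        Polynomial.aeval (MvPolynomial.X i : MvPolynomial (Fin r) A)
          (Polynomial.X ^ (j : ℕ) - Polynomial.X ^ (2 * r - j) : Polynomial A)).det) -
      (Matrix.of fun i j : Fin r =>
        Polynomial.aeval (MvPolynomial.X i : MvPolynomial (Fin r) A)
          ((1 + Polynomial.C t * Polynomial.X) * Polynomial.X ^ (j : ℕ) : Polynomial A)).det *
      (Matrix.of fun i j : Fin r =>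
        Polynomial.aeval (MvPolynomial.X i : MvPolynomial (Fin r) A)
          (Polynomial.X ^ (j : ℕ) : Polynomial A)).det := by
    have h1 : (Matrix.of fun i j : Fin r =>
        Polynomial.aeval (MvPolynomial.X i : MvPolynomial (Fin r) A)
          (Polynomial.X ^ (j : ℕ) : Polynomial A)).det = Vd Z := by
      rw [← Vd_eq]; simp [Z]
    have h2 : (Matrix.of fun i j : Fin r =>
        Polynomial.aeval (MvPolynomial.X i : MvPolynomial (Fin r) A)
          ((1 + Polynomial.C t * Polynomial.X) * Polynomial.X ^ (j : ℕ) : Polynomial A)).det =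
        (∏ i, (1 + MvPolynomial.C t * Z i)) * Vd Z := by
      rw [← Vd_eq, ← Matrix.det_mul_column]; simp [Z, MvPolynomial.algebraMap_eq]
    have h3 : (Matrix.of fun i j : Fin r =>
        Polynomial.aeval (MvPolynomial.X i : MvPolynomial (Fin r) A)
          (Polynomial.X ^ (j : ℕ) - Polynomial.X ^ (2 * r - j) : Polynomial A)).det =
        Vd Z * PP Z := by
      rw [← WW]; simp [Z]
    have h4 : ∀ d : Fin r → ℕ, (Matrix.of fun i j : Fin r =>
        Polynomial.aeval (MvPolynomial.X i : MvPolynomial (Fin r) A)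
          (Polynomial.X ^ d j : Polynomial A)).det = alt Z d := by
      intro d; simp [Z, alt]
    have h5 : ∀ d : Fin r → ℕ, wt 1 (MvPolynomial.C t : MvPolynomial (Fin r) A) d =
        MvPolynomial.C (wt 1 t d) := by
      intro d
      simp [wt, map_prod, apply_ite (MvPolynomial.C : A → MvPolynomial (Fin r) A)]
    rw [h1, h2, h3, mul_sub, AA, Finset.sum_mul, Finset.mul_sum]
    congr 1
    · refine Finset.sum_congr rfl fun d _ => ?_
      rw [h4, h5, MvPolynomial.smul_eq_C_mul]
      ring
    · ring
  rw [e1, map_sub, map_sum, andreief] at hL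
  simp only [map_smul, andreief] at hL
  have f1 : ∀ i j : Fin r, ell w ((1 + Polynomial.C t * Polynomial.X) * Polynomial.X ^ (i : ℕ) *
      Polynomial.X ^ (j : ℕ)) = hh ((c : ℤ) - (i : ℕ) + (Fin.rev j : ℕ)) +
      t * hh ((c : ℤ) - (i : ℕ) + (Fin.rev j : ℕ) - 1) := by
    intro i j
    have : (1 + Polynomial.C t * Polynomial.X) * Polynomial.X ^ (i : ℕ) *
      Polynomial.X ^ (j : ℕ) = Polynomial.X ^ ((i : ℕ) + j) +
        Polynomial.C t * Polynomial.X ^ ((i : ℕ) + j + 1) := by ring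
    rw [this, ell_add, ell_C_mul, ell_X_pow, ell_X_pow]
    have := j.2
    simp only [w, Fin.val_rev]
    congr 3 <;> omega
  have f2 : ∀ (d : Fin r → ℕ) (i j : Fin r), ell w (Polynomial.X ^ d i *
      (Polynomial.X ^ (j : ℕ) - Polynomial.X ^ (2 * r - j))) =
      hh ((c : ℤ) - (d i : ℕ) + (Fin.rev j : ℕ)) -
        hh ((c : ℤ) - (d i : ℕ) - (Fin.rev j : ℕ) - 2) := by
    intro d i j
    rw [mul_sub, ← pow_add, ← pow_add, ell_sub, ell_X_pow, ell_X_pow]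
    have := j.2
    simp only [w, Fin.val_rev]
    congr 2 <;> omega
  simp only [f1, f2] at hL
  rw [det_rev r (fun i j : Fin r => hh ((c : ℤ) - (i : ℕ) + (j : ℕ)) +
      t * hh ((c : ℤ) - (i : ℕ) + (j : ℕ) - 1))] at hL
  simp only [fun d : Fin r → ℕ => det_rev r (fun i j : Fin r => hh ((c : ℤ) - (d i : ℕ) + (j : ℕ)) -
        hh ((c : ℤ) - (d i : ℕ) - (j : ℕ) - 2)), smul_eq_mul] at hL
  have hr : ((r.factorial : ℕ) : A) ≠ 0 := by exact_mod_cast r.factorial_ne_zero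
  have hs : ((Equiv.Perm.sign (Fin.revPerm : Equiv.Perm (Fin r)) : ℤ) : A) ≠ 0 := by
    rcases Int.units_eq_one_or (Equiv.Perm.sign (Fin.revPerm : Equiv.Perm (Fin r))) with h | h <;>
      simp [h]
  apply mul_left_cancel₀ (mul_ne_zero hr hs)
  rw [Finset.mul_sum, mul_assoc, ← sub_eq_zero.1 hL]
  exact Finset.sum_congr rfl fun d _ => by ring


theorem coeff_core {A : Type*} [CommRing A] [IsDomain A] [CharZero A] (hh : ℤ → A)
    (hneg : ∀ m, m < 0 → hh m = 0) (r c p : ℕ) (hp : p ≤ r) :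
    (Matrix.of fun i j : Fin r => hh ((if (i : ℕ) < r - p then (c : ℤ) else (c : ℤ) - 1)
      - (i : ℕ) + (j : ℕ))).det =
    ∑ d ∈ (DD r (c + r)).filter (fun d =>
        (Finset.univ.filter fun i : Fin r => ¬ Even (d i + (i : ℕ))).card = p),
      (Matrix.of fun i j : Fin r =>
        hh ((c : ℤ) - (d i : ℕ) + (j : ℕ)) - hh ((c : ℤ) - (d i : ℕ) - (j : ℕ) - 2)).det := by
  have h := core (A := Polynomial A) Polynomial.X Polynomial.X_ne_zero
    (fun m => Polynomial.C (hh m)) (fun m hm => by rw [hneg m hm, map_zero]) r c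
  have hl := rows_aux r (Polynomial.X : Polynomial A)
    (fun i j => Polynomial.C (hh ((c : ℤ) - (i : ℕ) + (j : ℕ)))) r le_rfl
  have e : (Matrix.of fun i j : Fin r => Polynomial.C (hh ((c : ℤ) - (i : ℕ) + (j : ℕ))) +
      Polynomial.X * Polynomial.C (hh ((c : ℤ) - (i : ℕ) + (j : ℕ) - 1))) =
      (Matrix.of fun i : Fin r => if (i : ℕ) < r then
        (fun j : Fin r => Polynomial.C (hh ((c : ℤ) - (i : ℕ) + (j : ℕ)))) +
        (Polynomial.X : Polynomial A) •
          (fun j : Fin r => Polynomial.C (hh ((c : ℤ) - ((i + 1 : ℕ) : ℤ) + (j : ℕ))))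
        else (fun j : Fin r => Polynomial.C (hh ((c : ℤ) - ((i + 1 : ℕ) : ℤ) + (j : ℕ))))) := by
    ext1 i j
    simp only [Matrix.of_apply, i.2, if_true, Pi.add_apply, Pi.smul_apply, smul_eq_mul]
    congr 4
    push_cast; ring
  rw [e, hl] at h
  have hc := congrArg (fun q => Polynomial.coeff q p) h
  simp only [Polynomial.finsetSum_coeff] at hc
  have e1 : ∀ l ∈ Finset.range (r+1), ((Polynomial.X : Polynomial A) ^ (r - l) *
      (Matrix.of fun i : Fin r => if (i : ℕ) < l then
        (fun j : Fin r => Polynomial.C (hh ((c : ℤ) - (i : ℕ) + (j : ℕ))))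
        else (fun j : Fin r => Polynomial.C (hh ((c : ℤ) - ((i + 1 : ℕ) : ℤ) + (j : ℕ))))).det).coeff p =
      if l = r - p then (Matrix.of fun i j : Fin r =>
        hh ((if (i : ℕ) < l then (c : ℤ) else (c : ℤ) - 1) - (i : ℕ) + (j : ℕ))).det else 0 := by
    intro l hl
    rw [Finset.mem_range] at hl
    have : (Matrix.of fun i : Fin r => if (i : ℕ) < l then
        (fun j : Fin r => Polynomial.C (hh ((c : ℤ) - (i : ℕ) + (j : ℕ))))
        else (fun j : Fin r => Polynomial.C (hh ((c : ℤ) - ((i + 1 : ℕ) : ℤ) + (j : ℕ))))).det =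
        Polynomial.C (Matrix.of fun i j : Fin r =>
        hh ((if (i : ℕ) < l then (c : ℤ) else (c : ℤ) - 1) - (i : ℕ) + (j : ℕ))).det := by
      rw [RingHom.map_det]
      congr 1
      ext1 i j
      simp only [Matrix.of_apply, RingHom.mapMatrix_apply, Matrix.map_apply]
      split_ifs
      · rfl
      · push_cast
        ring_nf
    rw [this, Polynomial.coeff_mul_C, Polynomial.coeff_X_pow]
    by_cases hlp : l = r - p
    · rw [if_pos hlp, if_pos (by omega), one_mul]
    · rw [if_neg hlp, if_neg (by omega), zero_mul]
  rw [Finset.sum_congr rfl e1, Finset.sum_ite_eq', if_pos (by rw [Finset.mem_range]; omega)] at hc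
  rw [hc, Finset.sum_filter]
  refine Finset.sum_congr rfl fun d _ => ?_
  have e2 : (Matrix.of fun i j : Fin r =>
      (Polynomial.C (hh ((c : ℤ) - (d i : ℕ) + (j : ℕ))) -
        Polynomial.C (hh ((c : ℤ) - (d i : ℕ) - (j : ℕ) - 2)))).det = Polynomial.C
      (Matrix.of fun i j : Fin r =>
        hh ((c : ℤ) - (d i : ℕ) + (j : ℕ)) - hh ((c : ℤ) - (d i : ℕ) - (j : ℕ) - 2)).det := by
    rw [RingHom.map_det]
    congr 1
    ext1 i j
    simp
  have e3 : wt (1 : Polynomial A) Polynomial.X d =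
      Polynomial.X ^ (Finset.univ.filter fun i : Fin r => ¬ Even (d i + (i : ℕ))).card := by
    unfold wt
    rw [Finset.prod_ite, Finset.prod_const_one, one_mul, Finset.prod_const]
  rw [e2, e3, Polynomial.coeff_mul_C, Polynomial.coeff_X_pow]
  simp only [ite_mul, one_mul, zero_mul, eq_comm]

theorem map_hpoly {R T : Type} [CommRing R] [CommRing T] (f : R →+* T) {N : ℕ} (x : Fin N → R)
    (m : ℤ) : f (hpoly x m) = hpoly (fun i => f (x i)) m := by
  unfold hpoly
  split_ifs
  · simp [map_sum, map_prod]
  · simp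

theorem map_schur {R T : Type} [CommRing R] [CommRing T] (f : R →+* T) {N r : ℕ} (x : Fin N → R)
    (lam : Fin r → ℤ) : f (schur lam x) = schur lam (fun i => f (x i)) := by
  unfold schur
  rw [RingHom.map_det]
  congr 1
  ext i j
  simp [map_hpoly]

theorem map_oChar {R T : Type} [CommRing R] [CommRing T] (f : R →+* T) {N r : ℕ} (x : Fin N → R)
    (lam : Fin r → ℤ) : f (oChar lam x) = oChar lam (fun i => f (x i)) := by
  unfold oChar
  rw [RingHom.map_det]
  congr 1
  ext i j
  simp [map_hpoly]

theorem generic_case {A : Type} [CommRing A] [IsDomain A] [CharZero A] (r c p N : ℕ) (hpr : p ≤ r)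
    (x : Fin N → A) :
    schur (fun i : Fin r => if (i : ℕ) < r - p then (c : ℤ) else (c : ℤ) - 1) x
      = ∑ ν ∈ ((Fintype.piFinset fun _ : Fin r => Finset.range (c + 1)).filter
            (fun ν => Antitone ν ∧ oddRowsCount c ν = p)),
          oChar (fun i => (ν i : ℤ)) x := by
  unfold schur
  rw [coeff_core (hpoly x) (fun m hm => by simp [hpoly, not_le.2 hm]) r c p hpr]
  have bd : ∀ d ∈ DD r (c + r), ∀ i : Fin r, (i : ℕ) ≤ d i ∧ d i ≤ c + i := by
    intro d hd i
    rw [mem_DD] at hd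
    have lo : ∀ n (h : n < r), n ≤ d ⟨n, h⟩ := by
      intro n
      induction n with
      | zero => intro h; omega
      | succ n ih =>
        intro h
        have h1 := ih (by omega)
        have h2 := hd.2 (show (⟨n, by omega⟩ : Fin r) < ⟨n+1, h⟩ by simp [Fin.lt_def])
        omega
    have hi : ∀ n (h : n < r), d ⟨r - 1 - n, by omega⟩ + n < c + r := by
      intro n
      induction n with
      | zero => intro h; simpa using hd.1 _
      | succ n ih =>
        intro h
        have h1 := ih (by omega)
        have h2 := hd.2 (show (⟨r - 1 - (n+1), by omega⟩ : Fin r) < ⟨r - 1 - n, by omega⟩ by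
          simp only [Fin.lt_def]; omega)
        omega
    refine ⟨lo i i.2, ?_⟩
    have h1 := hi (r - 1 - i) (by omega)
    have h2 : (⟨r - 1 - (r - 1 - i), by omega⟩ : Fin r) = i := by
      apply Fin.ext
      simp only
      omega
    rw [h2] at h1
    omega
  have par : ∀ a b n : ℕ, a + b = c + n → (Odd ((c : ℤ) - (b : ℤ)) ↔ ¬ Even (a + n)) := by
    intro a b n h
    rw [Nat.not_even_iff_odd, ← Int.odd_coe_nat]
    have : ((a + n : ℕ) : ℤ) = ((c : ℤ) - b) + 2 * n := by push_cast; omega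
    rw [this, Int.odd_add]
    simp
  refine Finset.sum_bij' (fun d _ i => c + i - d i) (fun ν _ i => c + i - ν i) ?_ ?_ ?_ ?_ ?_
  · intro d hd
    rw [Finset.mem_filter] at hd
    have hb := bd d hd.1
    rw [Finset.mem_filter, Fintype.mem_piFinset]
    refine ⟨fun i => ?_, ?_, ?_⟩
    · have := hb i
      rw [Finset.mem_range]; omega
    · have hm : ∀ (i : Fin r) (k : ℕ) (h : (i : ℕ) + k < r), d i + k ≤ d ⟨i + k, h⟩ := by
        intro i k
        induction k with
        | zero => intro h; simp
        | succ k ih =>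
          intro h
          have h1 := ih (by omega)
          have h2 := (mem_DD.1 hd.1).2 (show (⟨i + k, by omega⟩ : Fin r) < ⟨i + (k+1), h⟩ by
            simp [Fin.lt_def])
          omega
      intro i j hij
      rw [Fin.le_def] at hij
      have h1 := hm i (j - i) (by omega)
      have h2 : (⟨(i : ℕ) + (j - i), by omega⟩ : Fin r) = j := by
        apply Fin.ext; simp only; omega
      rw [h2] at h1
      simp only
      omega
    · rw [← hd.2, oddRowsCount]
      congr 1
      ext i
      rw [Finset.mem_filter, Finset.mem_filter]
      have := hb i
      rw [par (d i) (c + i - d i) i (by omega)]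
  · intro ν hν
    rw [Finset.mem_filter, Fintype.mem_piFinset] at hν
    obtain ⟨h1, h2, h3⟩ := hν
    have h1' : ∀ i, ν i ≤ c := fun i => by
      have := h1 i
      rw [Finset.mem_range] at this; omega
    rw [Finset.mem_filter, mem_DD]
    refine ⟨⟨fun i => ?_, fun i j hij => ?_⟩, ?_⟩
    · have := h1' i
      have := i.2
      omega
    · have := h2 hij.le
      have := h1' i
      rw [Fin.lt_def] at hij
      simp only
      omega
    · rw [← h3, oddRowsCount]
      congr 1
      ext i
      rw [Finset.mem_filter, Finset.mem_filter]
      have := h1' i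
      rw [par (c + i - ν i) (ν i) i (by omega)]
  · intro d hd
    rw [Finset.mem_filter] at hd
    have hb := bd d hd.1
    ext i
    have := hb i
    simp only
    omega
  · intro ν hν
    rw [Finset.mem_filter, Fintype.mem_piFinset] at hν
    ext i
    have := hν.1 i
    rw [Finset.mem_range] at this
    simp only
    omega
  · intro d hd
    rw [Finset.mem_filter] at hd
    have hb := bd d hd.1
    unfold oChar
    congr 1
    ext1 i j
    have := hb i
    simp only [Matrix.of_apply]
    congr 2 <;> omega

/-- `s((c^{r-p}, (c-1)^p); x) = ∑_{ν ⊆ (c^r), oddrows((c^r)/ν) = p} o(ν; x)`. -/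
theorem schur_eq_sum_oChar
    (r c p : ℕ) (hr : 1 ≤ r) (hc : 1 ≤ c) (hpr : p ≤ r)
    (N : ℕ) (R : Type) [CommRing R] (x : Fin N → R) :
    schur (fun i : Fin r => if (i : ℕ) < r - p then (c : ℤ) else (c : ℤ) - 1) x
      = ∑ ν ∈ ((Fintype.piFinset fun _ : Fin r => Finset.range (c + 1)).filter
            (fun ν => Antitone ν ∧ oddRowsCount c ν = p)),
          oChar (fun i => (ν i : ℤ)) x := by
  have h := congrArg (MvPolynomial.eval₂Hom (Int.castRingHom R) x)
    (generic_case r c p N hpr (MvPolynomial.X : Fin N → MvPolynomial (Fin N) ℤ))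
  rw [map_sum, map_schur] at h
  simp only [map_oChar, MvPolynomial.eval₂Hom_X'] at h
  exact h

end
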